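/- Let q be a prime power and let n, k₁, k₂, t be positive integers with k₁ ≥ t + 1, k₂ ≥ t + 1 and n ≥ k₁ + k₂ + t + 7. Suppose F₁ ⊆ M(k₁,n) and F₂ ⊆ M(k₂,n) are nonempty non-trivial cross t-intersecting families with τ_t(F₂) ≥ τ_t(F₁) and (τ_t(F₁), τ_t(F₂)) ≠ (t, t+1). Then for every M ∈ M(k₂+1,n) and every t-flat T with T ⊆ M: |F₁|·|F₂| < |A₁(M,T;k₁,t)|·|A₂(M,T;k₂,t)|. -/

import Mathlib

open Module Set

/-- Gaussian binomial coefficient `[n k]_q`, as a rational number, via the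
product formula `∏_{0 ≤ i < k} (q^{n-i} - 1)/(q^{k-i} - 1)`. -/
noncomputable def gaussQ (q n k : ℕ) : ℚ :=
  ∏ i ∈ Finset.range k, ((q : ℚ) ^ (n - i) - 1) / ((q : ℚ) ^ (k - i) - 1)

/-- `A` is a `k`-flat of the affine space `AG(n, q)` (with `q = |𝔽|`):
a coset `x + P` of a `k`-dimensional linear subspace `P` of `𝔽^n`. -/
def IsFlat (𝔽 : Type) [Field 𝔽] {n : ℕ} (k : ℕ) (A : Set (Fin n → 𝔽)) : Prop :=
  ∃ (P : Submodule 𝔽 (Fin n → 𝔽)) (x : Fin n → 𝔽),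
    Module.finrank 𝔽 ↥P = k ∧ A = {v | v - x ∈ P}

/-- `A` is a flat (in particular nonempty) of dimension at least `t`. -/
def DimGe (𝔽 : Type) [Field 𝔽] {n : ℕ} (t : ℕ) (A : Set (Fin n → 𝔽)) : Prop :=
  ∃ j, t ≤ j ∧ IsFlat 𝔽 j A

/-- Two families of flats are cross `t`-intersecting. -/
def CrossT (𝔽 : Type) [Field 𝔽] {n : ℕ} (t : ℕ)
    (F1 F2 : Set (Set (Fin n → 𝔽))) : Prop :=
  ∀ A ∈ F1, ∀ B ∈ F2, DimGe 𝔽 t (A ∩ B)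

/-- A pair of families is trivial: some `t`-flat is contained in every member. -/
def TrivialPair (𝔽 : Type) [Field 𝔽] {n : ℕ} (t : ℕ)
    (F1 F2 : Set (Set (Fin n → 𝔽))) : Prop :=
  ∃ T : Set (Fin n → 𝔽), IsFlat 𝔽 t T ∧ (∀ A ∈ F1, T ⊆ A) ∧ (∀ B ∈ F2, T ⊆ B)

/-- `T` is a `t`-cover of the family `F`: `dim (T ∩ A) ≥ t` for all `A ∈ F`. -/
def IsTCover (𝔽 : Type) [Field 𝔽] {n : ℕ} (t : ℕ) (T : Set (Fin n → 𝔽))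
    (F : Set (Set (Fin n → 𝔽))) : Prop :=
  ∀ A ∈ F, DimGe 𝔽 t (T ∩ A)

/-- `τ_t(F)`: the minimum dimension of a `t`-cover of `F`. -/
noncomputable def tauT (𝔽 : Type) [Field 𝔽] {n : ℕ} (t : ℕ)
    (F : Set (Set (Fin n → 𝔽))) : ℕ :=
  sInf {x | ∃ T : Set (Fin n → 𝔽), IsFlat 𝔽 x T ∧ IsTCover 𝔽 t T F}

/-- `A₁(M, T; k, t) = {F ∈ M(k,n) : T ⊆ F, dim(F ∩ M) ≥ t + 1}`. -/
def A1 (𝔽 : Type) [Field 𝔽] {n : ℕ} (M T : Set (Fin n → 𝔽)) (k t : ℕ) :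
    Set (Set (Fin n → 𝔽)) :=
  {F | IsFlat 𝔽 k F ∧ T ⊆ F ∧ DimGe 𝔽 (t + 1) (F ∩ M)}

/-- `A₂(M, T; k, t) = {F ∈ M(k,n) : T ⊆ F} ∪ {F ∈ M(k,n) : F ⊆ M, dim(F ∩ T) = t - 1}`. -/
def A2 (𝔽 : Type) [Field 𝔽] {n : ℕ} (M T : Set (Fin n → 𝔽)) (k t : ℕ) :
    Set (Set (Fin n → 𝔽)) :=
  {F | IsFlat 𝔽 k F ∧ T ⊆ F} ∪ {F | IsFlat 𝔽 k F ∧ F ⊆ M ∧ IsFlat 𝔽 (t - 1) (F ∩ T)}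

/-- `A₃(S; k) = {F ∈ M(k,n) : S ⊆ F}`. -/
def A3 (𝔽 : Type) [Field 𝔽] {n : ℕ} (S : Set (Fin n → 𝔽)) (k : ℕ) :
    Set (Set (Fin n → 𝔽)) :=
  {F | IsFlat 𝔽 k F ∧ S ⊆ F}

/-- `A₄(S; k, t) = {F ∈ M(k,n) : dim(F ∩ S) ≥ t}`. -/
def A4 (𝔽 : Type) [Field 𝔽] {n : ℕ} (S : Set (Fin n → 𝔽)) (k t : ℕ) :
    Set (Set (Fin n → 𝔽)) :=
  {F | IsFlat 𝔽 k F ∧ DimGe 𝔽 t (F ∩ S)}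

section Counting

variable {K V : Type*} [Field K] [AddCommGroup V] [Module K V]


/-- The number of `k`-dimensional subspaces containing `P`. -/
noncomputable def numAbove (k : ℕ) (P : Submodule K V) : ℕ :=
  {Q : Submodule K V | P ≤ Q ∧ finrank K ↥Q = k}.ncard

theorem ncard_submodule [Finite K] [Finite V] (P : Submodule K V) :
    (P : Set V).ncard = Nat.card K ^ finrank K ↥P := by
  rw [← Module.natCard_eq_pow_finrank (K := K) (V := ↥P)]
  exact (Nat.card_coe_set_eq (P : Set V)).symm

theorem ncard_submodule_diff [Finite K] [Finite V] {P Q : Submodule K V} (h : P ≤ Q) :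
    ((Q : Set V) \ P).ncard = Nat.card K ^ finrank K ↥Q - Nat.card K ^ finrank K ↥P := by
  rw [Set.ncard_sdiff (by exact_mod_cast h), ncard_submodule, ncard_submodule]

open Classical in
theorem numAbove_mul [Finite K] [Fintype V] (k : ℕ) (P : Submodule K V) :
    numAbove k P * (Nat.card K ^ k - Nat.card K ^ finrank K ↥P) =
      ∑ v ∈ Finset.univ.filter (· ∉ P), numAbove k (P ⊔ K ∙ v) := by
  have hfin := Fintype.ofFinite (Submodule K V)
  have key := Finset.sum_card_bipartiteAbove_eq_sum_card_bipartiteBelow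
    (s := Finset.univ.filter fun Q : Submodule K V => P ≤ Q ∧ finrank K ↥Q = k)
    (t := Finset.univ.filter fun v : V => v ∉ P) (fun (Q : Submodule K V) (v : V) => v ∈ Q)
  have h1 : ∀ Q ∈ Finset.univ.filter (fun Q : Submodule K V => P ≤ Q ∧ finrank K ↥Q = k),
      (Finset.bipartiteAbove (fun (Q : Submodule K V) (v : V) => v ∈ Q)
        (Finset.univ.filter fun v : V => v ∉ P) Q).card =
        Nat.card K ^ k - Nat.card K ^ finrank K ↥P := by
    intro Q hQ
    obtain ⟨hPQ, hk⟩ := (Finset.mem_filter.mp hQ).2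
    rw [← hk, ← ncard_submodule_diff hPQ, ← Set.ncard_coe_finset]
    congr 1
    ext v
    simp [Finset.bipartiteAbove, and_comm]
  rw [Finset.sum_congr rfl h1, Finset.sum_const, smul_eq_mul] at key
  rw [numAbove, Set.ncard_eq_toFinset_card', Set.toFinset_ofPred, key]
  refine Finset.sum_congr rfl fun v _ => ?_
  rw [numAbove, ← Set.ncard_coe_finset]
  congr 1
  ext Q
  simp only [Finset.bipartiteBelow, Finset.coe_filter, Finset.mem_filter, Finset.mem_univ,
    true_and, Set.mem_ofPred_eq, sup_le_iff, Submodule.span_singleton_le_iff_mem]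
  tauto

open Classical in
theorem card_filter_notMem [Finite K] [Fintype V] (P : Submodule K V) :
    (Finset.univ.filter (· ∉ P)).card = Nat.card K ^ finrank K V - Nat.card K ^ finrank K ↥P := by
  have h := ncard_submodule_diff (le_top : P ≤ ⊤)
  rw [finrank_top] at h
  rw [← h, ← Set.ncard_coe_finset]
  congr 1
  ext v
  simp

theorem numAbove_of_finrank_eq [Finite K] [Finite V] {k : ℕ} {P : Submodule K V}
    (h : finrank K ↥P = k) : numAbove k P = 1 := by
  rw [numAbove, Set.ncard_eq_one]
  refine ⟨P, ?_⟩
  ext Q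
  simp only [Set.mem_ofPred_eq, Set.mem_singleton_iff]
  constructor
  · rintro ⟨h1, h2⟩
    exact (Submodule.eq_of_le_of_finrank_eq h1 (h.trans h2.symm)).symm
  · rintro rfl
    exact ⟨le_rfl, h⟩

theorem numAbove_of_lt_finrank [Finite K] [Finite V] {k : ℕ} {P : Submodule K V}
    (h : k < finrank K ↥P) : numAbove k P = 0 := by
  rw [numAbove, Set.ncard_eq_zero]
  ext Q
  simp only [Set.mem_ofPred_eq, Set.mem_empty_iff_false, iff_false]
  rintro ⟨h1, h2⟩
  have := Submodule.finrank_mono h1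
  omega

theorem one_lt_natCard_field [Finite K] : 1 < Nat.card K := Finite.one_lt_card

/-- The number of `k`-dimensional subspaces above `P` depends only on the dimension of `P`. -/
theorem numAbove_congr [Finite K] [Finite V] {k : ℕ} {P P' : Submodule K V}
    (h : finrank K ↥P = finrank K ↥P') : numAbove k P = numAbove k P' := by
  classical
  have := Fintype.ofFinite V
  rcases lt_or_ge k (finrank K ↥P) with hk | hk
  · rw [numAbove_of_lt_finrank hk, numAbove_of_lt_finrank (h ▸ hk)]
  obtain ⟨d, hd⟩ := Nat.exists_eq_add_of_le hk
  induction d generalizing P P' with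
  | zero => rw [numAbove_of_finrank_eq hd.symm, numAbove_of_finrank_eq (by omega)]
  | succ d ih =>
    have hlt : Nat.card K ^ finrank K ↥P < Nat.card K ^ k :=
      Nat.pow_lt_pow_right one_lt_natCard_field (by omega)
    apply Nat.eq_of_mul_eq_mul_right (Nat.sub_pos_of_lt hlt)
    conv_rhs => rw [h]
    rw [numAbove_mul, numAbove_mul]
    rcases (Finset.univ.filter (· ∉ P)).eq_empty_or_nonempty with he | ⟨w, hw⟩
    · have h' : (Finset.univ.filter (· ∉ P')).card = 0 := by
        rw [card_filter_notMem, ← h, ← card_filter_notMem, he, Finset.card_empty]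
      rw [he, Finset.card_eq_zero.mp h', Finset.sum_empty, Finset.sum_empty]
    · simp only [Finset.mem_filter, Finset.mem_univ, true_and] at hw
      have hfw := Submodule.finrank_sup_span_singleton hw
      rw [Finset.sum_eq_card_nsmul (b := numAbove k (P ⊔ K ∙ w)),
        Finset.sum_eq_card_nsmul (b := numAbove k (P ⊔ K ∙ w)),
        card_filter_notMem, card_filter_notMem, h]
      · intro v hv
        simp only [Finset.mem_filter, Finset.mem_univ, true_and] at hv
        have hfv := Submodule.finrank_sup_span_singleton hv
        exact ih (by omega) (by omega) (by omega)
      · intro v hv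
        simp only [Finset.mem_filter, Finset.mem_univ, true_and] at hv
        have hfv := Submodule.finrank_sup_span_singleton hv
        exact ih (by omega) (by omega) (by omega)

/-- Raising the dimension of the lower space by one divides the number of `k`-dimensional spaces
above it by at least `q ^ (n - k)`. -/
theorem numAbove_mul_pow_le [Finite K] [Finite V] {k : ℕ} {P P' : Submodule K V}
    (hkn : k ≤ finrank K V) (h : finrank K ↥P' = finrank K ↥P + 1) :
    numAbove k P' * Nat.card K ^ (finrank K V - k) ≤ numAbove k P := by
  classical
  have := Fintype.ofFinite V
  rcases le_or_gt k (finrank K ↥P) with hk | hk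
  · rw [numAbove_of_lt_finrank (by omega : k < finrank K ↥P'), zero_mul]
    exact Nat.zero_le _
  have hlt : Nat.card K ^ finrank K ↥P < Nat.card K ^ k :=
    Nat.pow_lt_pow_right one_lt_natCard_field hk
  have key := numAbove_mul k P
  rw [Finset.sum_eq_card_nsmul (b := numAbove k P') , card_filter_notMem, smul_eq_mul] at key
  · apply Nat.le_of_mul_le_mul_right _ (Nat.sub_pos_of_lt hlt)
    rw [key, mul_assoc, mul_comm]
    refine Nat.mul_le_mul_right _ ?_
    rw [Nat.mul_sub, ← pow_add, Nat.sub_add_cancel hkn]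
    refine Nat.sub_le_sub_left ?_ _
    exact Nat.le_mul_of_pos_left _ (pow_pos (zero_lt_one.trans one_lt_natCard_field) _)
  · intro v hv
    simp only [Finset.mem_filter, Finset.mem_univ, true_and] at hv
    exact numAbove_congr ((Submodule.finrank_sup_span_singleton hv).trans h.symm)

theorem numAbove_le_pow [Finite K] [Finite V] {k d : ℕ} {P : Submodule K V}
    (h : finrank K ↥P + d = k) (hkn : k ≤ finrank K V) :
    numAbove k P ≤ Nat.card K ^ ((finrank K V - k + 1) * d) := by
  classical
  have := Fintype.ofFinite V
  have hq : 1 < Nat.card K := one_lt_natCard_field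
  induction d generalizing P with
  | zero => rw [numAbove_of_finrank_eq (by omega)]; simp
  | succ d ih =>
    have hlt : Nat.card K ^ finrank K ↥P < Nat.card K ^ k := Nat.pow_lt_pow_right hq (by omega)
    apply Nat.le_of_mul_le_mul_right _ (Nat.sub_pos_of_lt hlt)
    rw [numAbove_mul]
    calc _ ≤ (Finset.univ.filter (· ∉ P)).card • Nat.card K ^ ((finrank K V - k + 1) * d) := by
          refine Finset.sum_le_card_nsmul _ _ _ fun v hv => ?_
          simp only [Finset.mem_filter, Finset.mem_univ, true_and] at hv
          refine ih ?_
          rw [Submodule.finrank_sup_span_singleton hv]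
          omega
      _ ≤ _ := by
          rw [card_filter_notMem, smul_eq_mul, mul_add, mul_one, pow_add, mul_assoc, mul_comm]
          refine Nat.mul_le_mul_left _ ?_
          have h1 : Nat.card K ^ (finrank K ↥P + 1) ≤ Nat.card K ^ k :=
            Nat.pow_le_pow_right hq.le (by omega)
          have h2 : 2 * Nat.card K ^ finrank K ↥P ≤ Nat.card K ^ (finrank K ↥P + 1) := by
            rw [pow_succ']
            exact Nat.mul_le_mul_right _ hq
          have h3 : Nat.card K ^ finrank K V = Nat.card K ^ (finrank K V - k) * Nat.card K ^ k := by
            rw [← pow_add, Nat.sub_add_cancel hkn]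
          rw [h3, pow_succ, mul_assoc]
          refine (Nat.sub_le _ _).trans (Nat.mul_le_mul_left _ ?_)
          have h5 := h2.trans h1
          have h4 : Nat.card K ^ k ≤ 2 * (Nat.card K ^ k - Nat.card K ^ finrank K ↥P) := by omega
          exact h4.trans (Nat.mul_le_mul_right _ hq)

/-- A space of dimension `t + a` has at most `q ^ ((t + 1) * a)` subspaces of dimension `t`. -/
theorem ncard_submodule_finrank_le [Finite K] [Finite V] {t a : ℕ} (h : finrank K V = t + a) :
    {P : Submodule K V | finrank K ↥P = t}.ncard ≤ Nat.card K ^ ((t + 1) * a) := by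
  have : Finite (Dual K V) := Module.finite_of_finite K
  have h1 : {P : Submodule K V | finrank K ↥P = t}.ncard ≤
      {Q : Submodule K (Dual K V) | ⊥ ≤ Q ∧ finrank K ↥Q = a}.ncard := by
    refine Set.ncard_le_ncard_of_injOn Submodule.dualAnnihilator ?_ ?_ (Set.toFinite _)
    · intro P hP
      have := Subspace.finrank_add_finrank_dualAnnihilator_eq P
      simp only [Set.mem_ofPred_eq] at hP
      exact ⟨bot_le, by omega⟩
    · intro P _ Q _ hPQ
      exact Subspace.dualAnnihilator_inj.mp hPQ
  have hd : finrank K (Dual K V) = t + a := by rw [Subspace.dual_finrank_eq, h]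
  have h2 := numAbove_le_pow (k := a) (d := a) (P := (⊥ : Submodule K (Dual K V)))
    (by rw [finrank_bot, zero_add]) (by omega)
  rw [hd, Nat.add_sub_cancel] at h2
  exact h1.trans h2

end Counting

theorem ncard_biUnion_le_mul {ι α : Type*} {C : Set ι} (hC : C.Finite) {f : ι → Set α} {m : ℕ}
    (h : ∀ i ∈ C, (f i).ncard ≤ m) : (⋃ i ∈ C, f i).ncard ≤ C.ncard * m := by
  induction C, hC using Set.Finite.induction_on with
  | empty => simp
  | @insert a s ha hs ih =>
    rw [Set.biUnion_insert, Set.ncard_insert_of_notMem ha hs, add_mul, one_mul, add_comm]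
    refine (Set.ncard_union_le _ _).trans (add_le_add (h a (Set.mem_insert _ _)) (ih fun i hi => ?_))
    exact h i (Set.mem_insert_of_mem _ hi)

theorem ncard_mul_le_ncard_biUnion_add {ι α : Type*} [Finite α] {C : Set ι} (hC : C.Finite)
    {f : ι → Set α} {m y : ℕ} (hm : ∀ i ∈ C, m ≤ (f i).ncard)
    (hy : ∀ i ∈ C, ∀ j ∈ C, i ≠ j → (f i ∩ f j).ncard ≤ y) :
    C.ncard * m ≤ (⋃ i ∈ C, f i).ncard + C.ncard ^ 2 * y := by
  induction C, hC using Set.Finite.induction_on with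
  | empty => simp
  | @insert a s ha hs ih =>
    rw [Set.biUnion_insert, Set.ncard_insert_of_notMem ha hs]
    have h1 := ih (fun i hi => hm i (Set.mem_insert_of_mem _ hi)) fun i hi j hj =>
      hy i (Set.mem_insert_of_mem _ hi) j (Set.mem_insert_of_mem _ hj)
    have h2 := Set.ncard_union_add_ncard_inter (f a) (⋃ i ∈ s, f i)
    have h3 : (f a ∩ ⋃ i ∈ s, f i).ncard ≤ s.ncard * y := by
      rw [Set.inter_iUnion₂]
      refine ncard_biUnion_le_mul hs fun i hi => hy a (Set.mem_insert _ _) i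
        (Set.mem_insert_of_mem _ hi) ?_
      rintro rfl
      exact ha hi
    have h4 := hm a (Set.mem_insert _ _)
    nlinarith

theorem exists_submodule_le_finrank_eq {K V : Type*} [Field K] [AddCommGroup V] [Module K V]
    {P : Submodule K V} {r : ℕ} (h : r ≤ finrank K ↥P) : ∃ Q ≤ P, finrank K ↥Q = r := by
  obtain ⟨f, hf⟩ := exists_linearIndependent_of_le_finrank h
  refine ⟨Submodule.span K (Set.range (P.subtype ∘ f)), ?_, ?_⟩
  · rw [Submodule.span_le]
    rintro _ ⟨i, rfl⟩
    exact (f i).2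
  · rw [finrank_span_eq_card (hf.map' P.subtype (Submodule.ker_subtype P)), Fintype.card_fin]

section Flats

variable {𝔽 : Type} [Field 𝔽] {n : ℕ}

/-- The flat through `x` with direction `P`. -/
def flatOf (x : Fin n → 𝔽) (P : Submodule 𝔽 (Fin n → 𝔽)) : Set (Fin n → 𝔽) :=
  {v | v - x ∈ P}

theorem mem_flatOf {x v : Fin n → 𝔽} {P : Submodule 𝔽 (Fin n → 𝔽)} :
    v ∈ flatOf x P ↔ v - x ∈ P := Iff.rfl

theorem self_mem_flatOf (x : Fin n → 𝔽) (P : Submodule 𝔽 (Fin n → 𝔽)) : x ∈ flatOf x P := by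
  rw [mem_flatOf, sub_self]
  exact P.zero_mem

theorem add_mem_flatOf {x v : Fin n → 𝔽} {P : Submodule 𝔽 (Fin n → 𝔽)} :
    x + v ∈ flatOf x P ↔ v ∈ P := by
  rw [mem_flatOf, add_sub_cancel_left]

theorem flatOf_eq_of_mem {x y : Fin n → 𝔽} {P : Submodule 𝔽 (Fin n → 𝔽)} (h : y ∈ flatOf x P) :
    flatOf x P = flatOf y P := by
  ext v
  rw [mem_flatOf, mem_flatOf, ← Submodule.sub_mem_iff_left (x := v - x) P h]
  simp

theorem flatOf_subset_flatOf {x : Fin n → 𝔽} {P Q : Submodule 𝔽 (Fin n → 𝔽)} :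
    flatOf x P ⊆ flatOf x Q ↔ P ≤ Q := by
  refine ⟨fun h v hv => add_mem_flatOf.mp (h (add_mem_flatOf.mpr hv)), fun h v hv => h hv⟩

theorem flatOf_injective (x : Fin n → 𝔽) :
    Function.Injective (flatOf x : Submodule 𝔽 (Fin n → 𝔽) → Set (Fin n → 𝔽)) := fun _ _ h =>
  le_antisymm (flatOf_subset_flatOf.mp h.le) (flatOf_subset_flatOf.mp h.ge)

theorem flatOf_inter (x : Fin n → 𝔽) (P Q : Submodule 𝔽 (Fin n → 𝔽)) :
    flatOf x P ∩ flatOf x Q = flatOf x (P ⊓ Q) := rfl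

theorem flatOf_inter_of_mem {x y z : Fin n → 𝔽} {P Q : Submodule 𝔽 (Fin n → 𝔽)}
    (hx : z ∈ flatOf x P) (hy : z ∈ flatOf y Q) :
    flatOf x P ∩ flatOf y Q = flatOf z (P ⊓ Q) := by
  rw [flatOf_eq_of_mem hx, flatOf_eq_of_mem hy, flatOf_inter]

theorem IsFlat.nonempty {k : ℕ} {A : Set (Fin n → 𝔽)} (h : IsFlat 𝔽 k A) : A.Nonempty := by
  obtain ⟨P, x, -, rfl⟩ := h
  exact ⟨x, self_mem_flatOf x P⟩

theorem IsFlat.exists_eq_flatOf {k : ℕ} {A : Set (Fin n → 𝔽)} (h : IsFlat 𝔽 k A)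
    {x : Fin n → 𝔽} (hx : x ∈ A) :
    ∃ P : Submodule 𝔽 (Fin n → 𝔽), finrank 𝔽 ↥P = k ∧ A = flatOf x P := by
  obtain ⟨P, y, hP, rfl⟩ := h
  exact ⟨P, hP, flatOf_eq_of_mem hx⟩

theorem isFlat_flatOf {k : ℕ} {x : Fin n → 𝔽} {P : Submodule 𝔽 (Fin n → 𝔽)} :
    IsFlat 𝔽 k (flatOf x P) ↔ finrank 𝔽 ↥P = k := by
  refine ⟨fun h => ?_, fun h => ⟨P, x, h, rfl⟩⟩
  obtain ⟨Q, hQ, he⟩ := h.exists_eq_flatOf (self_mem_flatOf x P)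
  rw [flatOf_injective x he, hQ]

theorem dimGe_flatOf {t : ℕ} {x : Fin n → 𝔽} {P : Submodule 𝔽 (Fin n → 𝔽)} :
    DimGe 𝔽 t (flatOf x P) ↔ t ≤ finrank 𝔽 ↥P := by
  refine ⟨fun ⟨j, hj, h⟩ => ?_, fun h => ⟨_, h, isFlat_flatOf.mpr rfl⟩⟩
  rwa [isFlat_flatOf.mp h]

theorem DimGe.nonempty {t : ℕ} {A : Set (Fin n → 𝔽)} (h : DimGe 𝔽 t A) : A.Nonempty := by
  obtain ⟨j, -, hA⟩ := h
  exact hA.nonempty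

theorem DimGe.exists_isFlat_subset {t : ℕ} {A : Set (Fin n → 𝔽)} (h : DimGe 𝔽 t A) :
    ∃ S, IsFlat 𝔽 t S ∧ S ⊆ A := by
  obtain ⟨j, hj, P, x, hP, rfl⟩ := h
  obtain ⟨Q, hQP, hQ⟩ := exists_submodule_le_finrank_eq (hj.trans hP.ge)
  exact ⟨flatOf x Q, isFlat_flatOf.mpr hQ, flatOf_subset_flatOf.mpr hQP⟩

theorem IsFlat.eq_of_subset {t : ℕ} {S A : Set (Fin n → 𝔽)} (hS : IsFlat 𝔽 t S)
    (hA : IsFlat 𝔽 t A) (h : S ⊆ A) : S = A := by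
  obtain ⟨x, hx⟩ := hS.nonempty
  obtain ⟨P, hP, rfl⟩ := hS.exists_eq_flatOf hx
  obtain ⟨Q, hQ, rfl⟩ := hA.exists_eq_flatOf (h hx)
  rw [Submodule.eq_of_le_of_finrank_eq (flatOf_subset_flatOf.mp h) (hP.trans hQ.symm)]

theorem ncard_flats_above [Finite 𝔽] (k : ℕ) (x : Fin n → 𝔽) (P : Submodule 𝔽 (Fin n → 𝔽)) :
    {A | IsFlat 𝔽 k A ∧ flatOf x P ⊆ A}.ncard = numAbove k P := by
  rw [numAbove, ← Set.ncard_image_of_injective _ (flatOf_injective x)]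
  congr 1
  ext A
  constructor
  · rintro ⟨hA, hPA⟩
    obtain ⟨Q, hQ, rfl⟩ := hA.exists_eq_flatOf (hPA (self_mem_flatOf x P))
    exact ⟨Q, ⟨flatOf_subset_flatOf.mp hPA, hQ⟩, rfl⟩
  · rintro ⟨Q, ⟨hPQ, hQ⟩, rfl⟩
    exact ⟨isFlat_flatOf.mpr hQ, flatOf_subset_flatOf.mpr hPQ⟩

theorem ncard_flatOf [Finite 𝔽] (x : Fin n → 𝔽) (P : Submodule 𝔽 (Fin n → 𝔽)) :
    (flatOf x P).ncard = Nat.card 𝔽 ^ finrank 𝔽 ↥P := by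
  rw [← ncard_submodule P, ← Set.ncard_image_of_injective (P : Set (Fin n → 𝔽))
    (add_right_injective x)]
  congr 1
  ext v
  simp only [mem_flatOf, Set.mem_image, SetLike.mem_coe]
  exact ⟨fun h => ⟨v - x, h, by simp⟩, by rintro ⟨w, hw, rfl⟩; simpa using hw⟩

/-- If a flat `S` meets a `k`-flat `B` in dimension less than `t`, the flats through `S` that meet
`B` in dimension at least `t` all contain one of at most `q ^ (k - t + 1)` one-step extensions
of `S`. -/
theorem exists_extension_set [Finite 𝔽] {k t : ℕ} (htk : t ≤ k) {x : Fin n → 𝔽}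
    {P : Submodule 𝔽 (Fin n → 𝔽)} {B : Set (Fin n → 𝔽)} (hB : IsFlat 𝔽 k B)
    (h : ¬ DimGe 𝔽 t (flatOf x P ∩ B)) :
    ∃ C : Set (Fin n → 𝔽), C.ncard ≤ Nat.card 𝔽 ^ (k - t + 1) ∧ (∀ v ∈ C, v ∉ P) ∧
      ∀ Q : Submodule 𝔽 (Fin n → 𝔽), P ≤ Q → DimGe 𝔽 t (flatOf x Q ∩ B) → ∃ v ∈ C, v ∈ Q := by
  obtain ⟨b, hb⟩ := hB.nonempty
  obtain ⟨W, hW, rfl⟩ := hB.exists_eq_flatOf hb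
  obtain ⟨C₀, hdisj, hsup⟩ :=
    IsModularLattice.exists_disjoint_and_sup_eq (inf_le_right : P ⊓ W ≤ W)
  have hC₀W : C₀ ≤ W := hsup ▸ le_sup_right
  have hdim : finrank 𝔽 ↥(P ⊓ W) + finrank 𝔽 ↥C₀ = k := by
    have := Submodule.finrank_sup_add_finrank_inf_eq (P ⊓ W) C₀
    rw [hsup, hdisj.eq_bot, finrank_bot, hW] at this
    omega
  rcases lt_or_ge (finrank 𝔽 ↥(P ⊓ W)) t with hlt | hge
  · obtain ⟨C₁, hC₁, hfin⟩ :=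
      exists_submodule_le_finrank_eq (P := C₀) (r := k - t + 1) (by omega)
    refine ⟨(C₁ : Set (Fin n → 𝔽)) \ {0}, ?_, ?_, ?_⟩
    · rw [← hfin, ← ncard_submodule]
      exact Set.ncard_le_ncard Set.sdiff_subset
    · rintro v ⟨hv, hv0⟩ hvP
      have := Submodule.disjoint_def.mp hdisj v ⟨hvP, hC₀W (hC₁ hv)⟩ (hC₁ hv)
      exact hv0 this
    · intro Q _ hQ
      obtain ⟨y, hy⟩ := hQ.nonempty
      rw [flatOf_inter_of_mem hy.1 hy.2, dimGe_flatOf] at hQ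
      have h1 := Submodule.finrank_sup_add_finrank_inf_eq C₁ (Q ⊓ W)
      have h2 : finrank 𝔽 ↥(C₁ ⊔ Q ⊓ W) ≤ k :=
        hW ▸ Submodule.finrank_mono (sup_le (hC₁.trans hC₀W) inf_le_right)
      have h3 : C₁ ⊓ (Q ⊓ W) ≠ ⊥ := by
        intro hbot
        rw [hbot, finrank_bot] at h1
        omega
      obtain ⟨v, hv, hv0⟩ := Submodule.exists_mem_ne_zero_of_ne_bot h3
      exact ⟨v, ⟨hv.1, hv0⟩, hv.2.1⟩
  · refine ⟨(fun c => b + c - x) '' (C₀ : Set (Fin n → 𝔽)), ?_, ?_, ?_⟩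
    · refine (Set.ncard_image_le (Set.toFinite _)).trans ?_
      rw [ncard_submodule]
      exact Nat.pow_le_pow_right Nat.card_pos (by omega)
    · rintro _ ⟨c, hc, rfl⟩ hcP
      refine h ?_
      rw [flatOf_inter_of_mem (z := b + c) hcP (add_mem_flatOf.mpr (hC₀W hc)), dimGe_flatOf]
      exact hge
    · intro Q hPQ hQ
      obtain ⟨y, hyQ, hyW⟩ := hQ.nonempty
      rw [mem_flatOf, ← hsup, Submodule.mem_sup] at hyW
      obtain ⟨d, hd, c, hc, hdc⟩ := hyW
      refine ⟨b + c - x, ⟨c, hc, rfl⟩, ?_⟩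
      have : b + c - x = (y - x) - d := by
        rw [eq_sub_of_add_eq' hdc]
        abel
      rw [this]
      exact Q.sub_mem hyQ (hPQ hd.1)

/-- Members of `F` through a flat that meets some member of the opposite family in dimension less
than `t`, bounded in terms of members through flats of one dimension more. -/
theorem ncard_members_above_le_of_not_dimGe [Finite 𝔽] {k k' t c : ℕ} (htk : t ≤ k')
    {F : Set (Set (Fin n → 𝔽))} (hF : ∀ A ∈ F, IsFlat 𝔽 k A) {B : Set (Fin n → 𝔽)}
    (hB : IsFlat 𝔽 k' B) (hFB : ∀ A ∈ F, DimGe 𝔽 t (A ∩ B))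
    {x : Fin n → 𝔽} {P : Submodule 𝔽 (Fin n → 𝔽)} (hBP : ¬ DimGe 𝔽 t (flatOf x P ∩ B))
    (hc : ∀ Q : Submodule 𝔽 (Fin n → 𝔽), finrank 𝔽 ↥Q = finrank 𝔽 ↥P + 1 →
      {A ∈ F | flatOf x Q ⊆ A}.ncard ≤ c) :
    {A ∈ F | flatOf x P ⊆ A}.ncard ≤ Nat.card 𝔽 ^ (k' - t + 1) * c := by
  obtain ⟨C, hCcard, hCP, hC⟩ := exists_extension_set htk hB hBP
  have hsub : {A ∈ F | flatOf x P ⊆ A} ⊆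
      ⋃ v ∈ C, {A ∈ F | flatOf x (P ⊔ 𝔽 ∙ v) ⊆ A} := by
    rintro A ⟨hA, hPA⟩
    obtain ⟨Q, hQ, rfl⟩ := (hF A hA).exists_eq_flatOf (hPA (self_mem_flatOf x P))
    rw [flatOf_subset_flatOf] at hPA
    obtain ⟨v, hv, hvQ⟩ := hC Q hPA (hFB _ hA)
    simp only [Set.mem_iUnion]
    refine ⟨v, hv, hA, flatOf_subset_flatOf.mpr (sup_le hPA ?_)⟩
    rwa [Submodule.span_singleton_le_iff_mem]
  refine (Set.ncard_le_ncard hsub).trans ((ncard_biUnion_le_mul (Set.toFinite C) fun v hv =>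
    hc _ ?_).trans (Nat.mul_le_mul_right _ hCcard))
  exact Submodule.finrank_sup_span_singleton (hCP v hv)

theorem ncard_members_above_le_numAbove [Finite 𝔽] {k : ℕ} {F : Set (Set (Fin n → 𝔽))}
    (hF : ∀ A ∈ F, IsFlat 𝔽 k A) (x : Fin n → 𝔽) (P : Submodule 𝔽 (Fin n → 𝔽)) :
    {A ∈ F | flatOf x P ⊆ A}.ncard ≤ numAbove k P := by
  rw [← ncard_flats_above k x P]
  exact Set.ncard_le_ncard fun A hA => ⟨hF A hA.1, hA.2⟩

/-- Members of `F` through a fixed flat, when no flat of dimension less than `m` is a `t`-cover of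
the opposite family. -/
theorem ncard_members_above_le [Finite 𝔽] {k k' t m r c : ℕ} (htk : t ≤ k')
    {F F' : Set (Set (Fin n → 𝔽))} (hF : ∀ A ∈ F, IsFlat 𝔽 k A) (hF' : ∀ B ∈ F', IsFlat 𝔽 k' B)
    (hcross : CrossT 𝔽 t F F') (hm : ∀ s < m, ∀ S, IsFlat 𝔽 s S → ¬ IsTCover 𝔽 t S F')
    {x : Fin n → 𝔽} {P : Submodule 𝔽 (Fin n → 𝔽)} (hr : finrank 𝔽 ↥P + r = m)
    (hc : ∀ Q : Submodule 𝔽 (Fin n → 𝔽), finrank 𝔽 ↥Q = m → numAbove k Q ≤ c) :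
    {A ∈ F | flatOf x P ⊆ A}.ncard ≤ Nat.card 𝔽 ^ ((k' - t + 1) * r) * c := by
  induction r generalizing P with
  | zero =>
    rw [mul_zero, pow_zero, one_mul]
    exact (ncard_members_above_le_numAbove hF x P).trans (hc P hr)
  | succ r ih =>
    have hcov := hm _ (by omega) (flatOf x P) (isFlat_flatOf.mpr rfl)
    simp only [IsTCover, not_forall] at hcov
    obtain ⟨B, hB, hBP⟩ := hcov
    refine (ncard_members_above_le_of_not_dimGe htk hF (hF' B hB) (fun A hA => hcross A hA B hB) hBP
      fun Q hQ => ih (P := Q) (by omega)).trans_eq ?_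
    ring

theorem ncard_submodule_le_finrank_le [Finite 𝔽] {t a : ℕ} {W : Submodule 𝔽 (Fin n → 𝔽)}
    (h : finrank 𝔽 ↥W = t + a) :
    {P : Submodule 𝔽 (Fin n → 𝔽) | P ≤ W ∧ finrank 𝔽 ↥P = t}.ncard ≤
      Nat.card 𝔽 ^ ((t + 1) * a) := by
  refine le_trans ?_ (ncard_submodule_finrank_le h)
  refine Set.ncard_le_ncard_of_injOn (Submodule.comap W.subtype) ?_ ?_ (Set.toFinite _)
  · rintro P ⟨hPW, hP⟩
    rw [Set.mem_ofPred_eq, ← hP]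
    exact (Submodule.comapSubtypeEquivOfLe hPW).finrank_eq
  · rintro P ⟨hP, -⟩ Q ⟨hQ, -⟩ hPQ
    have := congrArg (Submodule.map W.subtype) hPQ
    rwa [Submodule.map_comap_subtype, Submodule.map_comap_subtype, inf_eq_right.mpr hP,
      inf_eq_right.mpr hQ] at this

open Classical in
/-- A `(t + a)`-flat contains at most `q ^ ((t + 2) * a)` flats of dimension `t`. -/
theorem ncard_flats_below_le [Finite 𝔽] {t a : ℕ} {T : Set (Fin n → 𝔽)}
    (hT : IsFlat 𝔽 (t + a) T) :
    {S | IsFlat 𝔽 t S ∧ S ⊆ T}.ncard ≤ Nat.card 𝔽 ^ ((t + 2) * a) := by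
  have := Fintype.ofFinite (Fin n → 𝔽)
  have key := Finset.card_mul_le_card_mul (fun (S : Set (Fin n → 𝔽)) (y : Fin n → 𝔽) => y ∈ S)
    (s := {S | IsFlat 𝔽 t S ∧ S ⊆ T}.toFinset) (t := T.toFinset)
    (m := Nat.card 𝔽 ^ t) (n := Nat.card 𝔽 ^ ((t + 1) * a)) ?_ ?_
  · rw [← Set.ncard_eq_toFinset_card', ← Set.ncard_eq_toFinset_card'] at key
    obtain ⟨x, hx⟩ := hT.nonempty
    obtain ⟨W, hW, rfl⟩ := hT.exists_eq_flatOf hx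
    rw [ncard_flatOf, hW] at key
    refine Nat.le_of_mul_le_mul_right (key.trans_eq ?_) (pow_pos Nat.card_pos t)
    ring
  · intro S hS
    obtain ⟨hS, hST⟩ := Set.mem_toFinset.mp hS
    obtain ⟨x, hx⟩ := hS.nonempty
    obtain ⟨P, hP, rfl⟩ := hS.exists_eq_flatOf hx
    rw [← hP, ← ncard_flatOf x P, ← Set.ncard_coe_finset]
    refine Set.ncard_le_ncard fun y hy => ?_
    simpa [Finset.bipartiteAbove] using ⟨hST hy, hy⟩
  · intro y hy
    rw [Set.mem_toFinset] at hy
    obtain ⟨W, hW, rfl⟩ := hT.exists_eq_flatOf hy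
    refine le_trans ?_ (ncard_submodule_le_finrank_le hW)
    rw [← Set.ncard_coe_finset, ← Set.ncard_image_of_injective _ (flatOf_injective y)]
    refine Set.ncard_le_ncard fun S hS => ?_
    simp only [Finset.bipartiteBelow, Finset.coe_filter, Set.mem_toFinset, Set.mem_ofPred_eq] at hS
    obtain ⟨⟨hS, hSW⟩, hyS⟩ := hS
    obtain ⟨P, hP, rfl⟩ := hS.exists_eq_flatOf hyS
    exact ⟨P, ⟨flatOf_subset_flatOf.mp hSW, hP⟩, rfl⟩

/-- Bound on a family having a `t`-cover of dimension `t + a`, when the opposite family has no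
`t`-cover of dimension less than `t + b`. -/
theorem ncard_family_le [Finite 𝔽] {k k' t a b c : ℕ} (htk : t ≤ k')
    {F F' : Set (Set (Fin n → 𝔽))} (hF : ∀ A ∈ F, IsFlat 𝔽 k A) (hF' : ∀ B ∈ F', IsFlat 𝔽 k' B)
    (hcross : CrossT 𝔽 t F F') {T : Set (Fin n → 𝔽)} (hT : IsFlat 𝔽 (t + a) T)
    (hTF : IsTCover 𝔽 t T F)
    (hm : ∀ s < t + b, ∀ S, IsFlat 𝔽 s S → ¬ IsTCover 𝔽 t S F')
    (hc : ∀ Q : Submodule 𝔽 (Fin n → 𝔽), finrank 𝔽 ↥Q = t + b → numAbove k Q ≤ c) :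
    F.ncard ≤ Nat.card 𝔽 ^ ((t + 2) * a) * (Nat.card 𝔽 ^ ((k' - t + 1) * b) * c) := by
  have hsub : F ⊆ ⋃ S ∈ {S | IsFlat 𝔽 t S ∧ S ⊆ T}, {A ∈ F | S ⊆ A} := by
    intro A hA
    obtain ⟨S, hS, hSA⟩ := (hTF A hA).exists_isFlat_subset
    simp only [Set.mem_iUnion]
    exact ⟨S, ⟨hS, hSA.trans Set.inter_subset_left⟩, hA, hSA.trans Set.inter_subset_right⟩
  refine (Set.ncard_le_ncard hsub).trans ?_
  refine (ncard_biUnion_le_mul (m := Nat.card 𝔽 ^ ((k' - t + 1) * b) * c) (Set.toFinite _) ?_).trans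
    (Nat.mul_le_mul_right _ (ncard_flats_below_le hT))
  rintro S ⟨⟨P, x, hP, rfl⟩, -⟩
  exact ncard_members_above_le htk hF hF' hcross hm (by omega) hc

end Flats

section Bounds

variable {𝔽 : Type} [Field 𝔽] {n : ℕ}

/-- The counts `numAbove k P` as a function of the dimension of `P`. -/
theorem exists_numAbove_eq [Finite 𝔽] {k : ℕ} (hkn : k ≤ n) :
    ∃ g : ℕ → ℕ, (∀ P : Submodule 𝔽 (Fin n → 𝔽), numAbove k P = g (finrank 𝔽 ↥P)) ∧
      (∀ j r, g (j + r) * Nat.card 𝔽 ^ ((n - k) * r) ≤ g j) ∧ ∀ j ≤ k, 0 < g j := by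
  classical
  have hn : finrank 𝔽 (Fin n → 𝔽) = n := Module.finrank_fin_fun 𝔽
  have hsub : ∀ j ≤ n, ∃ P : Submodule 𝔽 (Fin n → 𝔽), finrank 𝔽 ↥P = j := by
    intro j hj
    obtain ⟨P, -, hP⟩ := exists_submodule_le_finrank_eq (K := 𝔽)
      (P := (⊤ : Submodule 𝔽 (Fin n → 𝔽))) (r := j) (by rw [finrank_top, hn]; exact hj)
    exact ⟨P, hP⟩
  have hg : ∃ g : ℕ → ℕ, (∀ P : Submodule 𝔽 (Fin n → 𝔽), numAbove k P = g (finrank 𝔽 ↥P)) ∧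
      ∀ j, n < j → g j = 0 := by
    choose! f hf using hsub
    refine ⟨fun j => if j ≤ n then numAbove k (f j) else 0, fun P => ?_, fun j hj => ?_⟩
    · have hP : finrank 𝔽 ↥P ≤ n := (Submodule.finrank_le P).trans hn.le
      simp only [hP, if_true]
      exact numAbove_congr (hf _ hP).symm
    · exact if_neg (by omega)
  obtain ⟨g, hg, hg0⟩ := hg
  have hstep : ∀ j, g (j + 1) * Nat.card 𝔽 ^ (n - k) ≤ g j := by
    intro j
    rcases lt_or_ge n (j + 1) with hj | hj
    · rw [hg0 _ hj, zero_mul]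
      exact Nat.zero_le _
    · obtain ⟨P, hP⟩ := hsub j (by omega)
      obtain ⟨P', hP'⟩ := hsub (j + 1) hj
      have := numAbove_mul_pow_le (k := k) (P := P) (P' := P') (by omega) (by omega)
      rwa [hg, hg, hP, hP', hn] at this
  refine ⟨g, hg, fun j r => ?_, fun j hj => ?_⟩
  · induction r with
    | zero => simp
    | succ r ih =>
      refine le_trans ?_ ih
      calc g (j + (r + 1)) * Nat.card 𝔽 ^ ((n - k) * (r + 1))
          = g (j + r + 1) * Nat.card 𝔽 ^ (n - k) * Nat.card 𝔽 ^ ((n - k) * r) := by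
            rw [mul_assoc, ← pow_add, ← add_assoc]
            congr 2
            ring
        _ ≤ _ := Nat.mul_le_mul_right _ (hstep _)
  · obtain ⟨Q, hQ⟩ := hsub k hkn
    obtain ⟨P, hPQ, hP⟩ := exists_submodule_le_finrank_eq (hj.trans hQ.ge)
    rw [← hP, ← hg, numAbove, Set.ncard_pos]
    exact ⟨Q, hPQ, hQ⟩

/-- A space of dimension `t + e + 1` above a `t`-dimensional `P` has `q ^ e` vectors that are
pairwise independent modulo `P`. -/
theorem exists_independent_vectors [Finite 𝔽] {t e : ℕ} {P W : Submodule 𝔽 (Fin n → 𝔽)}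
    (hPW : P ≤ W) (hP : finrank 𝔽 ↥P = t) (hW : finrank 𝔽 ↥W = t + e + 1) :
    ∃ C : Set (Fin n → 𝔽), C.ncard = Nat.card 𝔽 ^ e ∧ (∀ v ∈ C, v ∈ W ∧ v ∉ P) ∧
      ∀ v ∈ C, ∀ w ∈ C, v ≠ w → w ∉ P ⊔ 𝔽 ∙ v := by
  obtain ⟨D, hdisj, hsup⟩ := IsModularLattice.exists_disjoint_and_sup_eq hPW
  have hDW : D ≤ W := hsup ▸ le_sup_right
  have hD : finrank 𝔽 ↥D = e + 1 := by
    have := Submodule.finrank_sup_add_finrank_inf_eq P D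
    rw [hsup, hdisj.eq_bot, finrank_bot, hW] at this
    omega
  obtain ⟨E, hED, hE⟩ := exists_submodule_le_finrank_eq (P := D) (r := e) (by omega)
  obtain ⟨u, huD, huE⟩ : ∃ u ∈ D, u ∉ E := by
    by_contra! hall
    have := Submodule.finrank_mono (show D ≤ E from hall)
    omega
  have hmul : ∀ a : 𝔽, a • u ∈ E → a = 0 := by
    intro a ha
    by_contra ha0
    exact huE ((Submodule.smul_mem_iff E ha0).mp ha)
  have hD0 : ∀ v ∈ D, v ∈ P → v = 0 := fun v hv hvP => Submodule.disjoint_def.mp hdisj v hvP hv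
  refine ⟨(u + ·) '' (E : Set (Fin n → 𝔽)), ?_, ?_, ?_⟩
  · rw [Set.ncard_image_of_injective _ (add_right_injective u), ncard_submodule, hE]
  · rintro _ ⟨c, hc, rfl⟩
    have hmem : u + c ∈ D := D.add_mem huD (hED hc)
    refine ⟨hDW hmem, fun hcP => huE ?_⟩
    rw [eq_neg_of_add_eq_zero_left (hD0 _ hmem hcP)]
    exact E.neg_mem hc
  · rintro _ ⟨c, hc, rfl⟩ _ ⟨d, hd, rfl⟩ hne hmem
    apply hne
    obtain ⟨p, hp, z, hz, hpz⟩ := Submodule.mem_sup.mp hmem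
    obtain ⟨a, rfl⟩ := Submodule.mem_span_singleton.mp hz
    have hpe : p = (u + d) - a • (u + c) := eq_sub_of_add_eq hpz
    have hp0 : p = 0 := hD0 p (hpe ▸ D.sub_mem (D.add_mem huD (hED hd))
      (D.smul_mem a (D.add_mem huD (hED hc)))) hp
    have hE' : (1 - a) • u = a • c - d := by
      have h0 : (u + d) - a • (u + c) = 0 := hpe ▸ hp0
      rw [smul_add, sub_eq_zero] at h0
      rw [sub_smul, one_smul, sub_eq_sub_iff_add_eq_add, h0, add_comm]
    have ha : a = 1 := (sub_eq_zero.mp (hmul (1 - a)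
      (hE' ▸ E.sub_mem (E.smul_mem a hc) hd))).symm
    rw [ha, sub_self, zero_smul, one_smul] at hE'
    simp [sub_eq_zero.mp hE'.symm]

theorem lt_two_mul_ncard_A1 [Finite 𝔽] {k t e : ℕ} {g : ℕ → ℕ}
    (hg : ∀ P : Submodule 𝔽 (Fin n → 𝔽), numAbove k P = g (finrank 𝔽 ↥P))
    (hg1 : 0 < g (t + 1)) (hg2 : g (t + 2) * Nat.card 𝔽 ^ (e + 2) ≤ g (t + 1))
    {M T : Set (Fin n → 𝔽)} (hM : IsFlat 𝔽 (t + e + 1) M) (hT : IsFlat 𝔽 t T) (hTM : T ⊆ M) :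
    Nat.card 𝔽 ^ e * g (t + 1) < 2 * (A1 𝔽 M T k t).ncard := by
  obtain ⟨x, hx⟩ := hT.nonempty
  obtain ⟨P, hP, rfl⟩ := hT.exists_eq_flatOf hx
  obtain ⟨W, hW, rfl⟩ := hM.exists_eq_flatOf (hTM hx)
  rw [flatOf_subset_flatOf] at hTM
  obtain ⟨C, hC, hCW, hCind⟩ := exists_independent_vectors hTM hP hW
  have hq : 2 ≤ Nat.card 𝔽 := one_lt_natCard_field
  have hdim : ∀ v ∈ C, finrank 𝔽 ↥(P ⊔ 𝔽 ∙ v) = t + 1 := fun v hv => by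
    rw [Submodule.finrank_sup_span_singleton (hCW v hv).2, hP]
  have hunion := ncard_mul_le_ncard_biUnion_add (Set.toFinite C)
    (f := fun v => {A | IsFlat 𝔽 k A ∧ flatOf x (P ⊔ 𝔽 ∙ v) ⊆ A}) (m := g (t + 1))
    (y := g (t + 2)) ?_ ?_
  · have hsub : (⋃ v ∈ C, {A | IsFlat 𝔽 k A ∧ flatOf x (P ⊔ 𝔽 ∙ v) ⊆ A}) ⊆
        A1 𝔽 (flatOf x W) (flatOf x P) k t := by
      intro A hA
      simp only [Set.mem_iUnion] at hA
      obtain ⟨v, hv, hA, hvA⟩ := hA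
      refine ⟨hA, (flatOf_subset_flatOf.mpr le_sup_left).trans hvA, ?_⟩
      obtain ⟨Q, -, rfl⟩ := hA.exists_eq_flatOf (hvA (self_mem_flatOf x _))
      rw [flatOf_inter, dimGe_flatOf, ← hdim v hv]
      refine Submodule.finrank_mono (le_inf (flatOf_subset_flatOf.mp hvA) (sup_le hTM ?_))
      rw [Submodule.span_singleton_le_iff_mem]
      exact (hCW v hv).1
    have hle := Set.ncard_le_ncard hsub
    rw [hC] at hunion
    have hN : 0 < Nat.card 𝔽 ^ e := pow_pos (by omega) e
    have h4 : Nat.card 𝔽 ^ e * (4 * g (t + 2)) ≤ g (t + 1) := by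
      refine le_trans ?_ hg2
      rw [pow_add]
      have : 4 ≤ Nat.card 𝔽 ^ 2 := by nlinarith
      calc _ = g (t + 2) * (Nat.card 𝔽 ^ e * 4) := by ring
        _ ≤ _ := Nat.mul_le_mul_left _ (Nat.mul_le_mul_left _ this)
    have h5 := Nat.mul_le_mul_left (Nat.card 𝔽 ^ e) h4
    have h6 : 0 < Nat.card 𝔽 ^ e * g (t + 1) := Nat.mul_pos hN hg1
    nlinarith
  · intro v hv
    rw [ncard_flats_above, hg, hdim v hv]
  · intro v hv w hw hvw
    have hd : finrank 𝔽 ↥(P ⊔ 𝔽 ∙ v ⊔ 𝔽 ∙ w) = t + 2 := by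
      rw [Submodule.finrank_sup_span_singleton (hCind v hv w hw hvw), hdim v hv]
    rw [← hd, ← hg, ← ncard_flats_above k x]
    refine Set.ncard_le_ncard ?_
    rintro A ⟨⟨hA, hvA⟩, -, hwA⟩
    refine ⟨hA, ?_⟩
    obtain ⟨Q, -, rfl⟩ := hA.exists_eq_flatOf (hvA (self_mem_flatOf x _))
    rw [flatOf_subset_flatOf] at hvA hwA ⊢
    exact sup_le hvA (le_sup_right.trans hwA)

theorem le_ncard_A2 [Finite 𝔽] {k t : ℕ} {g : ℕ → ℕ}
    (hg : ∀ P : Submodule 𝔽 (Fin n → 𝔽), numAbove k P = g (finrank 𝔽 ↥P))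
    {M T : Set (Fin n → 𝔽)} (hT : IsFlat 𝔽 t T) : g t ≤ (A2 𝔽 M T k t).ncard := by
  obtain ⟨P, x, rfl, rfl⟩ := hT
  rw [← hg, ← ncard_flats_above k x]
  exact Set.ncard_le_ncard Set.subset_union_left

theorem exists_isFlat_isTCover_tauT {t : ℕ} {F : Set (Set (Fin n → 𝔽))} {S : Set (Fin n → 𝔽)}
    {s : ℕ} (hS : IsFlat 𝔽 s S) (hSF : IsTCover 𝔽 t S F) :
    ∃ T, IsFlat 𝔽 (tauT 𝔽 t F) T ∧ IsTCover 𝔽 t T F :=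
  Nat.sInf_mem (s := {x | ∃ T : Set (Fin n → 𝔽), IsFlat 𝔽 x T ∧ IsTCover 𝔽 t T F}) ⟨s, S, hS, hSF⟩

theorem not_isTCover_of_lt_tauT {t s : ℕ} {F : Set (Set (Fin n → 𝔽))} (hs : s < tauT 𝔽 t F)
    {S : Set (Fin n → 𝔽)} (hS : IsFlat 𝔽 s S) : ¬ IsTCover 𝔽 t S F :=
  fun h => Nat.notMem_of_lt_sInf hs ⟨S, hS, h⟩

theorem DimGe.le_of_isFlat_left {t s : ℕ} {S A : Set (Fin n → 𝔽)} (hS : IsFlat 𝔽 s S)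
    (h : DimGe 𝔽 t (S ∩ A)) : t ≤ s := by
  obtain ⟨R, hR, hRS⟩ := h.exists_isFlat_subset
  obtain ⟨x, hx⟩ := hR.nonempty
  obtain ⟨P, rfl, rfl⟩ := hR.exists_eq_flatOf hx
  obtain ⟨Q, rfl, rfl⟩ := hS.exists_eq_flatOf (hRS hx).1
  exact Submodule.finrank_mono (flatOf_subset_flatOf.mp (hRS.trans Set.inter_subset_left))

theorem DimGe.subset_of_isFlat_left {t : ℕ} {S A : Set (Fin n → 𝔽)} (hS : IsFlat 𝔽 t S)
    (h : DimGe 𝔽 t (S ∩ A)) : S ⊆ A := by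
  obtain ⟨R, hR, hRS⟩ := h.exists_isFlat_subset
  rw [← hR.eq_of_subset hS (hRS.trans Set.inter_subset_left)]
  exact hRS.trans Set.inter_subset_right

/-- Bound on a family whose members share a `t`-flat not contained in some flat `B` that meets
every member in dimension at least `t`. -/
theorem ncard_family_le_of_not_subset [Finite 𝔽] {k k' t : ℕ} (htk : t ≤ k') {g : ℕ → ℕ}
    (hg : ∀ P : Submodule 𝔽 (Fin n → 𝔽), numAbove k P = g (finrank 𝔽 ↥P))
    {F : Set (Set (Fin n → 𝔽))} (hF : ∀ A ∈ F, IsFlat 𝔽 k A) {T B : Set (Fin n → 𝔽)}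
    (hT : IsFlat 𝔽 t T) (hTF : ∀ A ∈ F, T ⊆ A) (hB : IsFlat 𝔽 k' B)
    (hFB : ∀ A ∈ F, DimGe 𝔽 t (A ∩ B)) (hTB : ¬ T ⊆ B) :
    F.ncard ≤ Nat.card 𝔽 ^ (k' - t + 1) * g (t + 1) := by
  obtain ⟨P, x, rfl, rfl⟩ := id hT
  have h := ncard_members_above_le_of_not_dimGe (c := g (finrank 𝔽 ↥P + 1)) htk hF hB hFB
    (x := x) (P := P) (fun h => hTB (h.subset_of_isFlat_left hT))
    fun Q hQ => (ncard_members_above_le_numAbove hF x Q).trans (by rw [hg, hQ])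
  refine le_trans (Set.ncard_le_ncard fun A hA => ?_) h
  exact ⟨hA, hTF A hA⟩

theorem mul_lt_mul_of_pow_bounds {q m N u c d a₁ a₂ E e : ℕ} (hq : 2 ≤ q)
    (hm : m * N * q ^ E ≤ q ^ u * (c * d)) (h1 : q ^ e * c < 2 * a₁) (h2 : d ≤ a₂) (hd : 0 < d)
    (hue : u + 1 ≤ e + E) : m * N < a₁ * a₂ := by
  have hq0 : 0 < q := by omega
  have h3 : q ^ e * c * d < 2 * a₁ * a₂ :=
    lt_of_lt_of_le (Nat.mul_lt_mul_of_pos_right h1 hd) (Nat.mul_le_mul_left _ h2)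
  have h4 : 2 * (m * N) * q ^ E ≤ q ^ e * c * d * q ^ E := by
    calc 2 * (m * N) * q ^ E = 2 * (m * N * q ^ E) := by ring
      _ ≤ q * (q ^ u * (c * d)) := Nat.mul_le_mul hq hm
      _ = q ^ (u + 1) * (c * d) := by ring
      _ ≤ q ^ (e + E) * (c * d) := Nat.mul_le_mul_right _ (Nat.pow_le_pow_right hq0 hue)
      _ = _ := by ring
  have h5 := Nat.le_of_mul_le_mul_right h4 (pow_pos hq0 E)
  have h6 : 2 * (m * N) < 2 * (a₁ * a₂) := by
    rw [← mul_assoc 2 a₁]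
    exact h5.trans_lt h3
  omega

end Bounds

theorem stmt_18 (q : ℕ) (hq : IsPrimePow q)
    (𝔽 : Type) [Field 𝔽] [Fintype 𝔽] (hcard : Fintype.card 𝔽 = q)
    (n k1 k2 t : ℕ) (ht : 0 < t) (hk1 : t + 1 ≤ k1) (hk2 : t + 1 ≤ k2)
    (hn : k1 + k2 + t + 7 ≤ n)
    (F1 F2 : Set (Set (Fin n → 𝔽))) (hne1 : F1.Nonempty) (hne2 : F2.Nonempty)
    (hF1 : ∀ A ∈ F1, IsFlat 𝔽 k1 A) (hF2 : ∀ B ∈ F2, IsFlat 𝔽 k2 B)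
    (hcross : CrossT 𝔽 t F1 F2) (hnontriv : ¬ TrivialPair 𝔽 t F1 F2)
    (htau : tauT 𝔽 t F1 ≤ tauT 𝔽 t F2)
    (htau' : ¬ (tauT 𝔽 t F1 = t ∧ tauT 𝔽 t F2 = t + 1))
    (M T : Set (Fin n → 𝔽))
    (hM : IsFlat 𝔽 (k2 + 1) M) (hT : IsFlat 𝔽 t T) (hTM : T ⊆ M) :
    F1.ncard * F2.ncard < (A1 𝔽 M T k1 t).ncard * (A2 𝔽 M T k2 t).ncard := by
  subst hcard
  have hq2 : 2 ≤ Nat.card 𝔽 := one_lt_natCard_field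
  obtain ⟨e1, rfl⟩ := Nat.exists_eq_add_of_le (by omega : t ≤ k1)
  obtain ⟨e2, rfl⟩ := Nat.exists_eq_add_of_le (by omega : t ≤ k2)
  obtain ⟨g1, hg1, hg1r, hg1pos⟩ :=
    exists_numAbove_eq (𝔽 := 𝔽) (n := n) (k := t + e1) (by omega)
  obtain ⟨g2, hg2, hg2r, hg2pos⟩ :=
    exists_numAbove_eq (𝔽 := 𝔽) (n := n) (k := t + e2) (by omega)
  have hA1 : Nat.card 𝔽 ^ e2 * g1 (t + 1) < 2 * (A1 𝔽 M T (t + e1) t).ncard := by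
    refine lt_two_mul_ncard_A1 hg1 (hg1pos _ (by omega)) (le_trans ?_ (hg1r (t + 1) 1)) hM hT hTM
    exact Nat.mul_le_mul_left _ (Nat.pow_le_pow_right (by omega) (by omega))
  have hA2 : g2 t ≤ (A2 𝔽 M T (t + e2) t).ncard := le_ncard_A2 hg2 hT
  have hd : 0 < g2 t := hg2pos _ (by omega)
  have hcross' : CrossT 𝔽 t F2 F1 := fun B hB A hA => Set.inter_comm A B ▸ hcross A hA B hB
  obtain ⟨A₀, hA₀⟩ := hne1
  obtain ⟨B₀, hB₀⟩ := hne2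
  obtain ⟨T1, hT1, hT1F⟩ := exists_isFlat_isTCover_tauT (hF2 B₀ hB₀) (hcross' B₀ hB₀)
  obtain ⟨T2, hT2, hT2F⟩ := exists_isFlat_isTCover_tauT (hF1 A₀ hA₀) (hcross A₀ hA₀)
  obtain ⟨a, ha⟩ := Nat.exists_eq_add_of_le ((hT1F A₀ hA₀).le_of_isFlat_left hT1)
  obtain ⟨b, hb⟩ := Nat.exists_eq_add_of_le ((hT2F B₀ hB₀).le_of_isFlat_left hT2)
  obtain ⟨d, hnd⟩ := Nat.exists_eq_add_of_le (by omega : (t + e1) + (t + e2) ≤ n)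
  have hn1 : n - (t + e1) = t + e2 + d := by omega
  have hn2 : n - (t + e2) = t + e1 + d := by omega
  rw [hn1] at hg1r
  rw [hn2] at hg2r
  rcases Nat.eq_zero_or_pos b with hb0 | hbpos
  · have ha0 : a = 0 := by omega
    rw [ha, ha0, add_zero] at hT1
    rw [hb, hb0, add_zero] at hT2
    have hT1A : ∀ A ∈ F1, T1 ⊆ A := fun A hA => (hT1F A hA).subset_of_isFlat_left hT1
    have hT2B : ∀ B ∈ F2, T2 ⊆ B := fun B hB => (hT2F B hB).subset_of_isFlat_left hT2
    obtain ⟨B, hB, hTB⟩ : ∃ B ∈ F2, ¬ T1 ⊆ B := by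
      by_contra! h
      exact hnontriv ⟨T1, hT1, hT1A, h⟩
    obtain ⟨A, hA, hTA⟩ : ∃ A ∈ F1, ¬ T2 ⊆ A := by
      by_contra! h
      exact hnontriv ⟨T2, hT2, h, hT2B⟩
    have h1 := ncard_family_le_of_not_subset (by omega) hg1 hF1 hT1 hT1A (hF2 B hB)
      (fun A hA => hcross A hA B hB) hTB
    have h2 := ncard_family_le_of_not_subset (by omega) hg2 hF2 hT2 hT2B (hF1 A hA)
      (fun B hB => hcross' B hB A hA) hTA
    rw [Nat.add_sub_cancel_left] at h1 h2
    have h3 := hg2r t 1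
    rw [mul_one] at h3
    refine mul_lt_mul_of_pow_bounds (u := e2 + 1 + (e1 + 1)) (E := t + e1 + d) hq2 ?_ hA1 hA2 hd
      (by omega)
    calc F1.ncard * F2.ncard * Nat.card 𝔽 ^ (t + e1 + d)
        ≤ (Nat.card 𝔽 ^ (e2 + 1) * g1 (t + 1)) * (Nat.card 𝔽 ^ (e1 + 1) * g2 (t + 1)) *
          Nat.card 𝔽 ^ (t + e1 + d) := Nat.mul_le_mul_right _ (Nat.mul_le_mul h1 h2)
      _ = Nat.card 𝔽 ^ (e2 + 1 + (e1 + 1)) *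
          (g1 (t + 1) * (g2 (t + 1) * Nat.card 𝔽 ^ (t + e1 + d))) := by ring
      _ ≤ _ := Nat.mul_le_mul_left _ (Nat.mul_le_mul_left _ h3)
  · obtain ⟨b, rfl⟩ := Nat.exists_eq_add_of_le' hbpos
    have hab : 1 ≤ a + b := by omega
    rw [ha] at hT1
    rw [hb] at hT2
    have h1 := ncard_family_le (by omega) hF1 hF2 hcross hT1 hT1F
      (fun s hs S hS => not_isTCover_of_lt_tauT (hb ▸ hs) hS) fun Q hQ => (by rw [hg1, hQ])
    have h2 := ncard_family_le (by omega) hF2 hF1 hcross' hT2 hT2F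
      (fun s hs S hS => not_isTCover_of_lt_tauT (ha ▸ hs) hS) fun Q hQ => (by rw [hg2, hQ])
    rw [Nat.add_sub_cancel_left] at h1 h2
    have h3 := hg1r (t + 1) b
    have h4 := hg2r t a
    refine mul_lt_mul_of_pow_bounds
      (u := (t + 2) * a + (e2 + 1) * (b + 1) + (t + 2) * (b + 1) + (e1 + 1) * a)
      (E := (t + e2 + d) * b + (t + e1 + d) * a) hq2 ?_ hA1 hA2 hd ?_
    · calc F1.ncard * F2.ncard * Nat.card 𝔽 ^ ((t + e2 + d) * b + (t + e1 + d) * a)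
          ≤ _ := Nat.mul_le_mul_right _ (Nat.mul_le_mul h1 h2)
        _ = Nat.card 𝔽 ^ ((t + 2) * a + (e2 + 1) * (b + 1) + (t + 2) * (b + 1) + (e1 + 1) * a) *
            ((g1 (t + 1 + b) * Nat.card 𝔽 ^ ((t + e2 + d) * b)) *
              (g2 (t + a) * Nat.card 𝔽 ^ ((t + e1 + d) * a))) := by
          rw [show t + 1 + b = t + (b + 1) by ring]
          simp only [pow_add]
          ring
        _ ≤ _ := Nat.mul_le_mul_left _ (Nat.mul_le_mul h3 h4)
    · have hd7 : t + 7 ≤ d := by omega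
      obtain ⟨f, rfl⟩ := Nat.exists_eq_add_of_le hd7
      nlinarith [Nat.mul_le_mul hab (le_refl (t + 4)), Nat.zero_le (f * (a + b))]
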